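/- For every vertex v₀ of a planar triangulation G and every integer k ≥ 0, the extended degree-bounded ball satisfies |V(B̄^8_k(v₀))| < 5^k · d(v₀). -/

import Mathlib

/-!
Common formal framework for statements from
"A near-linear time 4-coloring algorithm for planar graphs".

Plane embeddings are modelled combinatorially by rotation systems on darts
(Heffter–Edmonds): a graph together with a rotation system embeds in the
orientable surface whose faces are the orbits of the face-tracing permutation,
and the embedding is in the 2-sphere precisely when Euler's relation holds.
-/

namespace FourColor

open SimpleGraph

/-- Degree of a vertex, as the cardinality of its neighbour set. -/
noncomputable def vdeg {V : Type} (G : SimpleGraph V) (v : V) : ℕ :=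
  (G.neighborSet v).ncard

/-- Dart reversal, as a permutation of the darts of a graph. -/
def dartRev {V : Type} (G : SimpleGraph V) : Equiv.Perm G.Dart where
  toFun := SimpleGraph.Dart.symm
  invFun := SimpleGraph.Dart.symm
  left_inv d := SimpleGraph.Dart.symm_symm d
  right_inv d := SimpleGraph.Dart.symm_symm d

/-- A combinatorial embedding (rotation system) of a graph: a permutation of the
darts fixing tails, whose restriction to the darts out of each vertex is a
single cycle (the clockwise rotation around the vertex). -/
structure CombEmbedding {V : Type} (G : SimpleGraph V) where
  rot : Equiv.Perm G.Dart
  rot_fst : ∀ d : G.Dart, (rot d).toProd.1 = d.toProd.1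
  rot_cyclic : ∀ d d' : G.Dart, d.toProd.1 = d'.toProd.1 → ∃ n : ℕ, (rot ^ n) d = d'

namespace CombEmbedding

variable {V : Type} {G : SimpleGraph V}

/-- The face-tracing permutation of an embedding. -/
def facePerm (E : CombEmbedding G) : Equiv.Perm G.Dart :=
  (dartRev G).trans E.rot

/-- Two darts lie on the same face iff they are in the same orbit of the
face-tracing permutation. -/
def faceSetoid (E : CombEmbedding G) : Setoid G.Dart where
  r d d' := ∃ n : ℤ, (E.facePerm ^ n) d = d'
  iseqv := by
    refine ⟨fun d => ⟨0, by simp⟩, ?_, ?_⟩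
    · rintro d d' ⟨n, h⟩
      refine ⟨-n, ?_⟩
      rw [← h, ← Equiv.Perm.mul_apply, ← zpow_add, neg_add_cancel, zpow_zero,
        Equiv.Perm.one_apply]
    · rintro a b c ⟨m, h1⟩ ⟨n, h2⟩
      refine ⟨n + m, ?_⟩
      rw [← h2, ← h1, ← Equiv.Perm.mul_apply, ← zpow_add]

/-- The number of faces of an embedding. -/
noncomputable def numFaces (E : CombEmbedding G) : ℕ :=
  Nat.card (Quotient E.faceSetoid)

/-- Euler's relation characterising embeddings of a (possibly disconnected)
finite graph in the 2-sphere: `V - E + F = 2·(#components) - (#isolated vertices)`. -/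
def IsSpherical [Fintype V] (E : CombEmbedding G) : Prop :=
  (Fintype.card V : ℤ) - (G.edgeSet.ncard : ℤ) + (E.numFaces : ℤ) =
    2 * (Nat.card G.ConnectedComponent : ℤ) - (({v : V | ∀ w, ¬ G.Adj v w}).ncard : ℤ)

end CombEmbedding

/-- A finite simple graph is planar iff it admits a rotation system
satisfying Euler's relation for the sphere. -/
def IsPlanar {V : Type} [Fintype V] (G : SimpleGraph V) : Prop :=
  ∃ E : CombEmbedding G, E.IsSpherical

/-- A planar triangulation: a connected simple graph embedded in the 2-sphere
(Euler's relation) all of whose faces are triangles. -/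
structure PlaneTriangulation (V : Type) [Fintype V] where
  graph : SimpleGraph V
  emb : CombEmbedding graph
  conn : graph.Connected
  euler : (Fintype.card V : ℤ) - (graph.edgeSet.ncard : ℤ) + (emb.numFaces : ℤ) = 2
  faces_tri : ∀ d : graph.Dart, (emb.facePerm ^ 3) d = d ∧ emb.facePerm d ≠ d

/-- A near-triangulation: a connected plane graph, with a designated outer face,
all of whose faces except the outer one are triangles.  (The trivial
near-triangulations on a single vertex are allowed.) -/
structure NearTriangulation (V : Type) [Fintype V] where
  graph : SimpleGraph V
  emb : CombEmbedding graph
  conn : graph.Connected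
  euler : Fintype.card V = 1 ∨
    (Fintype.card V : ℤ) - (graph.edgeSet.ncard : ℤ) + (emb.numFaces : ℤ) = 2
  /-- membership of a dart in the (boundary walk of the) outer face -/
  isOuter : graph.Dart → Prop
  outer_closed : ∀ d, isOuter d → isOuter (emb.facePerm d)
  outer_single : ∀ d d', isOuter d → isOuter d' → ∃ n : ℕ, (emb.facePerm ^ n) d = d'
  outer_nonempty : ∀ _ : graph.Dart, ∃ d', isOuter d'
  inner_tri : ∀ d, ¬ isOuter d → (emb.facePerm ^ 3) d = d ∧ emb.facePerm d ≠ d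

namespace NearTriangulation

variable {V : Type} [Fintype V]

/-- A vertex lies on the outer face boundary. -/
def OnOuter (N : NearTriangulation V) (v : V) : Prop :=
  IsEmpty N.graph.Dart ∨ ∃ d : N.graph.Dart, N.isOuter d ∧ d.toProd.1 = v

/-- An edge lies on the outer face boundary. -/
def IsOuterEdge (N : NearTriangulation V) (x y : V) : Prop :=
  ∃ d : N.graph.Dart, N.isOuter d ∧ (d.toProd = (x, y) ∨ d.toProd = (y, x))

end NearTriangulation

/-- `v` is a cut-vertex of `G`: deleting it increases the number of
connected components. -/
def IsCutVertex {V : Type} (G : SimpleGraph V) (v : V) : Prop :=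
  Nat.card G.ConnectedComponent <
    Nat.card (G.induce {w : V | w ≠ v}).ConnectedComponent

/-- A configuration `(Z, δ)`: a near-triangulation together with a degree
function which agrees with the degree at interior vertices, exceeds it at
outer vertices, and with at most one cut-vertex, lying in exactly two blocks
and having external degree 2. -/
structure Configuration (V : Type) [Fintype V] extends NearTriangulation V where
  δ : V → ℕ
  delta_inner : ∀ v : V, ¬ toNearTriangulation.OnOuter v → δ v = vdeg graph v
  delta_outer : ∀ v : V, toNearTriangulation.OnOuter v → vdeg graph v < δ v
  cut_unique : ∀ u w : V, IsCutVertex graph u → IsCutVertex graph w → u = w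
  cut_cond : ∀ v : V, IsCutVertex graph v →
    Nat.card (graph.induce {w : V | w ≠ v}).ConnectedComponent = 2 ∧
    δ v = vdeg graph v + 2

/-- The map induced on darts by an adjacency-preserving vertex map. -/
def dartMap {A V : Type} {ZG : SimpleGraph A} {G : SimpleGraph V} (f : A → V)
    (h : ∀ ⦃a b : A⦄, ZG.Adj a b → G.Adj (f a) (f b)) (d : ZG.Dart) : G.Dart :=
  ⟨(f d.toProd.1, f d.toProd.2), h d.adj⟩

/-- An orientation-preserving homomorphism of a configuration into a plane
triangulation: adjacency-preserving, sending inner facial triangles to facial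
triangles with the same orientation, and matching the prescribed degrees. -/
def IsConfigHomMap {A V : Type} [Fintype A] [Fintype V] (C : Configuration A)
    (T : PlaneTriangulation V) (f : A → V) : Prop :=
  ∃ h : ∀ ⦃a b : A⦄, C.graph.Adj a b → T.graph.Adj (f a) (f b),
    (∀ v : A, vdeg T.graph (f v) = C.δ v) ∧
    (∀ d : C.graph.Dart, ¬ C.isOuter d →
      T.emb.facePerm (dartMap f h d) = dartMap f h (C.emb.facePerm d))

/-- `f` exhibits the configuration `C` as being contained in the plane
triangulation `T`: an injective orientation-preserving homomorphism matching
degrees; moreover at a cut-vertex the two incident edges of `T` not coming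
from `C` are non-consecutive in the rotation. -/
def IsContainMap {A V : Type} [Fintype A] [Fintype V] (C : Configuration A)
    (T : PlaneTriangulation V) (f : A → V) : Prop :=
  Function.Injective f ∧ IsConfigHomMap C T f ∧
  ∀ v : A, IsCutVertex C.graph v →
    ∀ e e' : T.graph.Dart, e.toProd.1 = f v → e'.toProd.1 = f v →
      (¬ ∃ a b : A, C.graph.Adj a b ∧ e.toProd = (f a, f b)) →
      (¬ ∃ a b : A, C.graph.Adj a b ∧ e'.toProd = (f a, f b)) →
      e ≠ e' → T.emb.rot e ≠ e'

/-- A configuration on a concrete finite vertex set. -/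
def ConfigOn : Type := Σ n : ℕ, Configuration (Fin n)

/-- The configuration `C` is contained in `T` within the set `S` of vertices. -/
def ConfigOn.ContainedIn (C : ConfigOn) {V : Type} [Fintype V]
    (T : PlaneTriangulation V) (S : Set V) : Prop :=
  ∃ f : Fin C.1 → V, IsContainMap C.2 T f ∧ Set.range f ⊆ S

/-- The configuration `C` is induced in `T` within the set `S` of vertices. -/
def ConfigOn.InducedIn (C : ConfigOn) {V : Type} [Fintype V]
    (T : PlaneTriangulation V) (S : Set V) : Prop :=
  ∃ f : Fin C.1 → V, IsContainMap C.2 T f ∧ Set.range f ⊆ S ∧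
    ∀ a b : Fin C.1, T.graph.Adj (f a) (f b) → C.2.graph.Adj a b

/-- Paper condition (ii) of Lemma `induced-config`: any two vertices at
distance exactly 4 are joined by a length-4 path which either is not contained
in the outer face boundary, or contains an internal vertex which is not a
cut-vertex and has external degree at least 2. -/
def SecondNbrCond {A : Type} [Fintype A] (C : Configuration A) : Prop :=
  ∀ u w : A, C.graph.dist u w = 4 →
    ∃ p : C.graph.Walk u w, p.IsPath ∧ p.length = 4 ∧
      ((¬ ∀ d ∈ p.darts, C.toNearTriangulation.IsOuterEdge d.toProd.1 d.toProd.2) ∨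
        ∃ x ∈ p.support, x ≠ u ∧ x ≠ w ∧ ¬ IsCutVertex C.graph x ∧
          vdeg C.graph x + 2 ≤ C.δ x)

/-! ### Balls and obstructing cycles -/

/-- The set of vertices at distance at most `k` from `v` (vertex set of `B_k(v)`). -/
def ballSet {V : Type} (G : SimpleGraph V) (v : V) (k : ℕ) : Set V :=
  {u | ∃ p : G.Walk v u, p.length ≤ k}

/-- Vertex set of the degree-bounded ball `B^8_k(v)`. -/
def dBallSet {V : Type} (G : SimpleGraph V) (v : V) (k : ℕ) : Set V :=
  {u | ∃ p : G.Walk v u, p.length ≤ k ∧ ∀ x ∈ p.support, x = v ∨ vdeg G x ≤ 8}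

/-- Vertex set of the extended degree-bounded ball `B̄^8_k(v)`. -/
def extdBallSet {V : Type} (G : SimpleGraph V) (v : V) (k : ℕ) : Set V :=
  dBallSet G v k ∪
    {u | 9 ≤ vdeg G u ∧ ∃ p : G.Walk v u, p.length ≤ k ∧
      ∀ x ∈ p.support, x = v ∨ x = u ∨ vdeg G x ≤ 8}

/-- An obstructing cycle: a cycle of length at most 4 with at least one vertex
on each of its two sides, or of length 5 with at least two vertices on each
side.  (The two sides of a cycle of a plane triangulation are unions of
components of the complement, with no edges from one side to the other.) -/
def IsObstructingCycle {V : Type} {G : SimpleGraph V} {x : V} (c : G.Walk x x) : Prop :=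
  c.IsCycle ∧
  ∃ A B : Set V,
    (∀ v : V, v ∉ c.support → v ∈ A ∨ v ∈ B) ∧
    (∀ v ∈ A, v ∉ c.support) ∧ (∀ v ∈ B, v ∉ c.support) ∧
    Disjoint A B ∧
    (∀ a ∈ A, ∀ b ∈ B, ¬ G.Adj a b) ∧
    ((c.length ≤ 4 ∧ A.Nonempty ∧ B.Nonempty) ∨
      (c.length = 5 ∧ 2 ≤ A.ncard ∧ 2 ≤ B.ncard))

/-- `G` has an obstructing cycle all of whose vertices lie in `S`. -/
def HasObstructingCycleIn {V : Type} (G : SimpleGraph V) (S : Set V) : Prop :=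
  ∃ (x : V) (c : G.Walk x x), IsObstructingCycle c ∧ ∀ y ∈ c.support, y ∈ S

/-- A chordless cycle: every edge of `G` between vertices of the cycle is an
edge of the cycle. -/
def IsChordless {V : Type} {G : SimpleGraph V} {x : V} (c : G.Walk x x) : Prop :=
  ∀ u v : V, u ∈ c.support → v ∈ c.support → G.Adj u v → s(u, v) ∈ c.edges

/-- Two vertex sets touch: they share a vertex, or an edge of `G` joins them. -/
def Touches {V : Type} (G : SimpleGraph V) (S S' : Set V) : Prop :=
  (S ∩ S').Nonempty ∨ ∃ s ∈ S, ∃ t ∈ S', G.Adj s t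

/-- A `k`-local obstructing cycle around `v`, with designated public part
`pub`: the cycle lies in `B̄^8_k(v)`, the public part consists of at most two
vertices which are consecutive on the cycle, and everything outside the public
part (the private part) lies in `B^8_k(v)`. -/
def IsLocalObstructing {V : Type} (G : SimpleGraph V) (v : V) (k : ℕ) {x : V}
    (c : G.Walk x x) (pub : Set V) : Prop :=
  IsObstructingCycle c ∧
  (∀ y ∈ c.support, y ∈ extdBallSet G v k) ∧
  pub ⊆ {y | y ∈ c.support} ∧
  pub.ncard ≤ 2 ∧
  (∀ y ∈ pub, ∀ z ∈ pub, y ≠ z → s(y, z) ∈ c.edges) ∧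
  (∀ y ∈ c.support, y ∉ pub → y ∈ dBallSet G v k)

/-! ### Discharging and charges -/

/-- Initial charge `T₀(v) = 10·(6 − d(v))`. -/
noncomputable def initialCharge {V : Type} (G : SimpleGraph V) (v : V) : ℤ :=
  10 * (6 - (vdeg G v : ℤ))

/-- Final charge of `v`, given the function `send u v` recording the total
charge sent from `u` to `v` by the discharging rules (`send u v = 0` for
non-adjacent `u, v`). -/
noncomputable def finalCharge {V : Type} [Fintype V] (G : SimpleGraph V)
    (send : V → V → ℤ) (v : V) : ℤ :=
  initialCharge G v + ∑ u : V, (send u v - send v u)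

/-- A discharging assignment: for every plane triangulation, an amount of
charge sent along each ordered pair of vertices, nonnegative and vanishing on
non-adjacent pairs.  (The paper's fixed set `ℛ` of 43 discharging rules
determines such an assignment.) -/
def IsDischargeAssignment
    (Φ : ∀ (V : Type) [Fintype V], PlaneTriangulation V → V → V → ℤ) : Prop :=
  ∀ (V : Type) [Fintype V] (T : PlaneTriangulation V) (u v : V),
    (¬ T.graph.Adj u v → Φ V T u v = 0) ∧ 0 ≤ Φ V T u v

/-! ### Colorings and Kempe changes -/

/-- A proper 4-coloring. -/
def IsProperColoring {U : Type} (G : SimpleGraph U) (c : U → Fin 4) : Prop :=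
  ∀ ⦃u v : U⦄, G.Adj u v → c u ≠ c v

/-- `u` and `w` lie in a common `ab`-Kempe chain inside `S`. -/
def KempeConnOn {U : Type} (G : SimpleGraph U) (S : Set U) (c : U → Fin 4)
    (a b : Fin 4) (u w : U) : Prop :=
  ∃ p : G.Walk u w, ∀ x ∈ p.support, x ∈ S ∧ (c x = a ∨ c x = b)

/-- A Kempe change (within the vertex set `S`): for complementary color pairs
`{a,b}` and `{e,f}`, swap the two colors on some `ab`-Kempe chains and some
`ef`-Kempe chains. -/
def IsKempeChangeOn {U : Type} (G : SimpleGraph U) (S : Set U)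
    (c c' : U → Fin 4) : Prop :=
  (∀ v ∉ S, c' v = c v) ∧
  ∃ a b e f : Fin 4, ({a, b, e, f} : Set (Fin 4)) = Set.univ ∧
    (∀ v ∈ S, c' v = c v ∨ (c v = a ∧ c' v = b) ∨ (c v = b ∧ c' v = a) ∨
      (c v = e ∧ c' v = f) ∨ (c v = f ∧ c' v = e)) ∧
    (∀ u w : U, (KempeConnOn G S c a b u w ∨ KempeConnOn G S c e f u w) →
      ((c' u = c u) ↔ (c' w = c w)))

/-- A Kempe change. -/
def IsKempeChange {U : Type} (G : SimpleGraph U) (c c' : U → Fin 4) : Prop :=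
  IsKempeChangeOn G Set.univ c c'

/-- A single Kempe change: swap two colors on one Kempe chain. -/
def IsSingleKempeChange {U : Type} (G : SimpleGraph U) (c c' : U → Fin 4) : Prop :=
  ∃ a b : Fin 4, a ≠ b ∧ ∃ u₀ : U, (c u₀ = a ∨ c u₀ = b) ∧
    ∀ v : U,
      (KempeConnOn G Set.univ c a b u₀ v →
        ((c v = a ∧ c' v = b) ∨ (c v = b ∧ c' v = a))) ∧
      (¬ KempeConnOn G Set.univ c a b u₀ v → c' v = c v)

/-- Two colorings agree up to a permutation of the colors. -/
def ColorPermEq {α : Type} (κ κ' : α → Fin 4) : Prop :=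
  ∃ σ : Equiv.Perm (Fin 4), ∀ x : α, κ' x = σ (κ x)

/-! ### Free completions, rings, reducibility -/

/-- A free completion of the configuration `C`, with ring vertex set `W`:
a near-triangulation on `A ⊕ W` whose outer face is the ring cycle on `W`
(disjoint from `C`), containing `C` with the prescribed degrees and inner
faces. -/
structure FreeCompletion {A : Type} [Fintype A] (C : Configuration A)
    (W : Type) [Fintype W] where
  nt : NearTriangulation (A ⊕ W)
  ring_outer : ∀ x : A ⊕ W, nt.OnOuter x ↔ ∃ w : W, x = Sum.inr w
  outer_simple : ∀ d d' : nt.graph.Dart, nt.isOuter d → nt.isOuter d' →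
    d.toProd.1 = d'.toProd.1 → d = d'
  adj_iff : ∀ a b : A, nt.graph.Adj (Sum.inl a) (Sum.inl b) ↔ C.graph.Adj a b
  deg_eq : ∀ a : A, vdeg nt.graph (Sum.inl a) = C.δ a
  faces_comm : ∀ d : C.graph.Dart, ¬ C.isOuter d →
    nt.emb.facePerm (dartMap Sum.inl (fun a b hab => (adj_iff a b).mpr hab) d) =
      dartMap Sum.inl (fun a b hab => (adj_iff a b).mpr hab) (C.emb.facePerm d)
  ring_edges_outer : ∀ w w' : W, nt.graph.Adj (Sum.inr w) (Sum.inr w') →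
    ∃ d : nt.graph.Dart, nt.isOuter d ∧
      ((d.toProd.1 = Sum.inr w ∧ d.toProd.2 = Sum.inr w') ∨
       (d.toProd.1 = Sum.inr w' ∧ d.toProd.2 = Sum.inr w))

namespace FreeCompletion

variable {A W : Type} [Fintype A] [Fintype W] {C : Configuration A}

/-- Adjacency on the ring. -/
def RingAdj (FC : FreeCompletion C W) (w w' : W) : Prop :=
  FC.nt.graph.Adj (Sum.inr w) (Sum.inr w')

/-- A proper 4-coloring of the ring. -/
def RingProper (FC : FreeCompletion C W) (κ : W → Fin 4) : Prop :=
  ∀ w w' : W, FC.RingAdj w w' → κ w ≠ κ w'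

end FreeCompletion

/-- `j` embeds a cycle into `G'` so that its image bounds a face of the
embedding `E'`. -/
def IsFacialEmbedding {W U : Type} {G' : SimpleGraph U} (E' : CombEmbedding G')
    (j : W → U) : Prop :=
  ∃ F : Set G'.Dart, F.Nonempty ∧ (∀ d ∈ F, E'.facePerm d ∈ F) ∧
    (∀ d ∈ F, ∀ d' ∈ F, ∃ n : ℕ, (E'.facePerm ^ n) d = d') ∧
    (∀ w : W, ∃ d ∈ F, d.toProd.1 = j w) ∧
    (∀ d ∈ F, (∃ w : W, d.toProd.1 = j w) ∧ (∃ w : W, d.toProd.2 = j w))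

/-- `i`-extendibility of a ring coloring `κ` (Birkhoff–Kempe reducibility):
`κ` is `0`-extendible if it extends to a proper 4-coloring of the free
completion; it is `(i+1)`-extendible if it is `i`-extendible or if, for every
plane graph `G'` containing the ring as a facial cycle and every proper
4-coloring of `G'` extending `κ`, some Kempe change yields a coloring whose
restriction to the ring is `i`-extendible. -/
def FreeCompletion.Extendible {A W : Type} [Fintype A] [Fintype W]
    {C : Configuration A} (FC : FreeCompletion C W) :
    ℕ → (W → Fin 4) → Prop
  | 0, κ => ∃ c : A ⊕ W → Fin 4, IsProperColoring FC.nt.graph c ∧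
      ∀ w : W, c (Sum.inr w) = κ w
  | (i + 1), κ => FreeCompletion.Extendible FC i κ ∨
      ∀ (U : Type) [Fintype U] (G' : SimpleGraph U) (E' : CombEmbedding G'),
        E'.IsSpherical →
        ∀ j : W → U, Function.Injective j →
          (∀ w w' : W, FC.RingAdj w w' ↔ G'.Adj (j w) (j w')) →
          IsFacialEmbedding E' j →
          ∀ c : U → Fin 4, IsProperColoring G' c → (∀ w : W, c (j w) = κ w) →
            ∃ c' : U → Fin 4, IsProperColoring G' c' ∧ IsKempeChange G' c c' ∧
              FreeCompletion.Extendible FC i (fun w => c' (j w))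

/-- The reducibility level of a ring coloring: the least `i` such that it is
`i`-extendible. -/
noncomputable def FreeCompletion.level {A W : Type} [Fintype A] [Fintype W]
    {C : Configuration A} (FC : FreeCompletion C W) (κ : W → Fin 4) : ℕ :=
  sInf {i : ℕ | FC.Extendible i κ}

/-- A configuration is D-reducible if, for some finite `i`, every proper
4-coloring of the ring of any free completion is `i`-extendible. -/
def DReducible {A : Type} [Fintype A] (C : Configuration A) : Prop :=
  ∃ i : ℕ, ∀ (W : Type) [Fintype W] (FC : FreeCompletion C W) (κ : W → Fin 4),
    FC.RingProper κ → FC.Extendible i κ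

/-- The defining properties of the paper's fixed set `𝒟` of 8202 D-reducible
configurations: each has at most 19 vertices, diameter at most 4, at most one
vertex of (prescribed) degree exceeding 8, ring size at most 18, and every
4-coloring of its ring is 25-extendible. -/
def DSetGood (𝓓 : Set ConfigOn) : Prop :=
  𝓓.ncard = 8202 ∧
  ∀ C ∈ 𝓓,
    C.1 ≤ 19 ∧
    (∀ a b : Fin C.1, C.2.graph.dist a b ≤ 4) ∧
    ({v : Fin C.1 | 8 < C.2.δ v}).ncard ≤ 1 ∧
    ∃ (r : ℕ) (FC : FreeCompletion C.2 (Fin r)), r ≤ 18 ∧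
      ∀ κ : Fin r → Fin 4, FC.RingProper κ → FC.Extendible 25 κ

end FourColor
namespace FourColor

namespace CombEmbedding

variable {V : Type} {G : SimpleGraph V}

theorem facePerm_fst (E : CombEmbedding G) (d : G.Dart) :
    (E.facePerm d).toProd.1 = d.toProd.2 :=
  E.rot_fst d.symm

/-- The third corner of a triangular face is adjacent to both ends of each of its darts. -/
theorem adj_facePerm_snd_of_pow_three (E : CombEmbedding G) {d : G.Dart}
    (h : (E.facePerm ^ 3) d = d) :
    G.Adj d.toProd.1 (E.facePerm d).toProd.2 ∧ G.Adj d.toProd.2 (E.facePerm d).toProd.2 ∧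
      (E.facePerm (E.facePerm d)).toProd = ((E.facePerm d).toProd.2, d.toProd.1) := by
  have h3 : E.facePerm (E.facePerm (E.facePerm d)) = d := h
  have e1 := E.facePerm_fst d
  have e2 := E.facePerm_fst (E.facePerm d)
  have e3 : (E.facePerm (E.facePerm d)).toProd.2 = d.toProd.1 := by
    rw [← E.facePerm_fst, h3]
  refine ⟨?_, ?_, Prod.ext e2 e3⟩
  · rw [← e2, ← e3]
    exact (E.facePerm (E.facePerm d)).adj.symm
  · rw [← e1]
    exact (E.facePerm d).adj

/-- If the rotation returns to a dart after two steps, its tail has degree at most two. -/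
theorem vdeg_le_two_of_rot_rot (E : CombEmbedding G) {d : G.Dart} (h : E.rot (E.rot d) = d) :
    vdeg G d.toProd.1 ≤ 2 := by
  have key : ∀ n : ℕ, (E.rot ^ n) d = d ∨ (E.rot ^ n) d = E.rot d := by
    intro n
    induction n with
    | zero => simp
    | succ n ih =>
      rw [pow_succ', Equiv.Perm.mul_apply]
      rcases ih with ih | ih <;> rw [ih]
      · exact Or.inr rfl
      · exact Or.inl h
  have hsub : G.neighborSet d.toProd.1 ⊆ {d.toProd.2, (E.rot d).toProd.2} := by
    intro x hx
    obtain ⟨n, hn⟩ := E.rot_cyclic d ⟨(d.toProd.1, x), hx⟩ rfl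
    rcases key n with hk | hk <;> rw [hn] at hk
    · exact Or.inl (congrArg (fun e : G.Dart => e.toProd.2) hk)
    · exact Or.inr (congrArg (fun e : G.Dart => e.toProd.2) hk)
  exact (Set.ncard_le_ncard hsub (Set.toFinite _)).trans
    ((Set.ncard_insert_le _ _).trans (by rw [Set.ncard_singleton]))

end CombEmbedding

namespace PlaneTriangulation

variable {V : Type} [Fintype V] (T : PlaneTriangulation V)

theorem exists_common_neighbors {y z : V} (h : T.graph.Adj y z) (hy : 3 ≤ vdeg T.graph y) :
    ∃ a b : V, a ≠ b ∧ T.graph.Adj y a ∧ T.graph.Adj z a ∧ T.graph.Adj y b ∧ T.graph.Adj z b := by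
  let d : T.graph.Dart := ⟨(y, z), h⟩
  obtain ⟨hb1, hb2, hb3⟩ := T.emb.adj_facePerm_snd_of_pow_three (T.faces_tri d).1
  obtain ⟨ha1, ha2, -⟩ := T.emb.adj_facePerm_snd_of_pow_three (T.faces_tri d.symm).1
  refine ⟨_, _, ?_, ha2, ha1, hb1, hb2⟩
  intro hab
  have hrot : T.emb.facePerm d.symm = T.emb.rot d :=
    congrArg T.emb.rot d.symm_symm
  have hsymm : (T.emb.facePerm (T.emb.facePerm d)).symm = T.emb.rot d := by
    refine SimpleGraph.Dart.ext _ _ ?_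
    rw [SimpleGraph.Dart.symm_toProd, hb3]
    refine Prod.ext (T.emb.rot_fst d).symm ?_
    rw [← hrot]
    exact hab.symm
  have hd : T.emb.rot (T.emb.rot d) = d := by
    rw [← hsymm]
    exact (T.faces_tri d).1
  have := T.emb.vdeg_le_two_of_rot_rot hd
  change vdeg T.graph y ≤ 2 at this
  omega

theorem exists_adj (v : V) : ∃ u, T.graph.Adj v u := by
  by_contra! hv
  have hsub : ∀ u, u = v := by
    intro u
    obtain ⟨p⟩ := T.conn.preconnected v u
    cases p with
    | nil => rfl
    | cons h _ => exact absurd h (hv _)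
  have : Subsingleton V := ⟨fun a b => (hsub a).trans (hsub b).symm⟩
  have hdart : IsEmpty T.graph.Dart :=
    ⟨fun d => d.adj.ne (Subsingleton.elim _ _)⟩
  have hV : Fintype.card V = 1 := Fintype.card_eq_one_iff.mpr ⟨v, hsub⟩
  have hF : T.emb.numFaces = 0 := by
    have : IsEmpty (Quotient T.emb.faceSetoid) := Quotient.instIsEmpty
    exact Nat.card_of_isEmpty
  have := T.euler
  rw [hV, hF] at this
  omega

theorem two_le_vdeg (v : V) : 2 ≤ vdeg T.graph v := by
  obtain ⟨u, hu⟩ := T.exists_adj v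
  obtain ⟨h1, h2, -⟩ :=
    T.emb.adj_facePerm_snd_of_pow_three (T.faces_tri ⟨(v, u), hu⟩).1
  rw [vdeg, ← Set.ncard_pair h2.ne]
  exact Set.ncard_le_ncard (Set.insert_subset hu (Set.singleton_subset_iff.mpr h1))

end PlaneTriangulation

section Growth

variable {V : Type} [Fintype V]

open Classical in
/-- Breadth-first layers from `v` which expand only `v` itself and vertices of degree at
most 8. -/
noncomputable def bfsBall (G : SimpleGraph V) (v : V) : ℕ → Finset V
  | 0 => {v}
  | k + 1 => bfsBall G v k ∪
      Finset.univ.filter (fun x => ∃ y ∈ bfsBall G v k, (y = v ∨ vdeg G y ≤ 8) ∧ G.Adj y x)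

theorem mem_bfsBall_succ {G : SimpleGraph V} {v x : V} {k : ℕ} :
    x ∈ bfsBall G v (k + 1) ↔
      x ∈ bfsBall G v k ∨ ∃ y ∈ bfsBall G v k, (y = v ∨ vdeg G y ≤ 8) ∧ G.Adj y x := by
  simp [bfsBall]

theorem bfsBall_mono (G : SimpleGraph V) (v : V) : Monotone (bfsBall G v) :=
  monotone_nat_of_le_succ fun _ _ hx => mem_bfsBall_succ.mpr (Or.inl hx)

theorem self_mem_bfsBall (G : SimpleGraph V) (v : V) (k : ℕ) : v ∈ bfsBall G v k :=
  bfsBall_mono G v (Nat.zero_le k) (by simp [bfsBall])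

theorem end_mem_bfsBall {G : SimpleGraph V} {v w u : V} (p : G.Walk w u) :
    ∀ j : ℕ, w ∈ bfsBall G v j → (∀ x ∈ p.support, x = v ∨ x = u ∨ vdeg G x ≤ 8) →
      u ∈ bfsBall G v (j + p.length) := by
  induction p with
  | nil => exact fun j hw _ => hw
  | @cons a b c hab q ih =>
    intro j hw hx
    have hstep (ha : a = v ∨ vdeg G a ≤ 8) : c ∈ bfsBall G v (j + (q.length + 1)) := by
      have := ih (j + 1) (mem_bfsBall_succ.mpr (Or.inr ⟨a, hw, ha, hab⟩))
        fun x hxq => hx x (by simp [hxq])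
      rwa [Nat.add_assoc, Nat.add_comm 1] at this
    rw [SimpleGraph.Walk.length_cons]
    rcases hx a (by simp) with h | h | h
    · exact hstep (Or.inl h)
    · have hc : c ∈ bfsBall G v j := h ▸ hw
      exact bfsBall_mono G v (Nat.le_add_right j _) hc
    · exact hstep (Or.inr h)

theorem extdBallSet_subset_bfsBall (G : SimpleGraph V) (v : V) (k : ℕ) :
    extdBallSet G v k ⊆ bfsBall G v k := by
  have key {u : V} (p : G.Walk v u) (hp : p.length ≤ k)
      (hx : ∀ x ∈ p.support, x = v ∨ x = u ∨ vdeg G x ≤ 8) : u ∈ bfsBall G v k :=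
    bfsBall_mono G v ((Nat.zero_add _).trans_le hp)
      (end_mem_bfsBall p 0 (self_mem_bfsBall G v 0) hx)
  rintro u (⟨p, hp, hx⟩ | ⟨-, p, hp, hx⟩)
  · exact key p hp fun x h => (hx x h).imp_right Or.inr
  · exact key p hp hx

open Classical in
theorem card_neighborFinset_sdiff_bfsBall_le (T : PlaneTriangulation V) {v y : V} {k : ℕ}
    (hy : y ∈ bfsBall T.graph v (k + 1)) (hy' : y ∉ bfsBall T.graph v k)
    (hdeg : vdeg T.graph y ≤ 8) :
    (T.graph.neighborFinset y \ bfsBall T.graph v (k + 1)).card ≤ 5 := by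
  have hcard : (T.graph.neighborFinset y).card = vdeg T.graph y :=
    (Set.ncard_eq_toFinset_card' _).symm
  rcases Nat.lt_or_ge (vdeg T.graph y) 3 with h3 | h3
  · have := Finset.card_le_card (Finset.sdiff_subset
      (s := T.graph.neighborFinset y) (t := bfsBall T.graph v (k + 1)))
    omega
  obtain ⟨z, hz, hzg, hzy⟩ := (mem_bfsBall_succ.mp hy).resolve_left hy'
  obtain ⟨a, b, hab, hya, hza, hyb, hzb⟩ := T.exists_common_neighbors hzy.symm h3
  have hsub : ({z, a, b} : Finset V) ⊆
      T.graph.neighborFinset y ∩ bfsBall T.graph v (k + 1) := by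
    intro x hx
    simp only [Finset.mem_insert, Finset.mem_singleton] at hx
    rw [Finset.mem_inter, SimpleGraph.mem_neighborFinset]
    rcases hx with rfl | rfl | rfl
    · exact ⟨hzy.symm, bfsBall_mono _ _ k.le_succ hz⟩
    · exact ⟨hya, mem_bfsBall_succ.mpr (Or.inr ⟨z, hz, hzg, hza⟩)⟩
    · exact ⟨hyb, mem_bfsBall_succ.mpr (Or.inr ⟨z, hz, hzg, hzb⟩)⟩
  have h1 := Finset.card_le_card hsub
  rw [Finset.card_eq_three.mpr ⟨z, a, b, hza.ne, hzb.ne, hab, rfl⟩] at h1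
  have h2 := Finset.card_sdiff_add_card_inter
    (T.graph.neighborFinset y) (bfsBall T.graph v (k + 1))
  omega

open Classical in
theorem card_bfsBall_succ_sdiff_le (T : PlaneTriangulation V) (v : V) (k : ℕ) :
    (bfsBall T.graph v (k + 1) \ bfsBall T.graph v k).card ≤ 5 ^ k * vdeg T.graph v := by
  induction k with
  | zero =>
    rw [pow_zero, one_mul, vdeg, ← Set.ncard_coe_finset]
    refine Set.ncard_le_ncard fun x hx => ?_
    obtain ⟨hx, hx'⟩ := Finset.mem_sdiff.mp (Finset.mem_coe.mp hx)
    obtain ⟨y, hy, -, hyx⟩ := (mem_bfsBall_succ.mp hx).resolve_left hx'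
    rw [bfsBall, Finset.mem_singleton] at hy
    simpa [← hy] using hyx
  | succ k ih =>
    let L := (bfsBall T.graph v (k + 1) \ bfsBall T.graph v k).filter
      (fun y => vdeg T.graph y ≤ 8)
    have hsub : bfsBall T.graph v (k + 2) \ bfsBall T.graph v (k + 1) ⊆
        L.biUnion fun y => T.graph.neighborFinset y \ bfsBall T.graph v (k + 1) := by
      intro x hx
      obtain ⟨hx, hx'⟩ := Finset.mem_sdiff.mp hx
      obtain ⟨y, hy, hyg, hyx⟩ := (mem_bfsBall_succ.mp hx).resolve_left hx'
      have hyk : y ∉ bfsBall T.graph v k := fun h =>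
        hx' (mem_bfsBall_succ.mpr (Or.inr ⟨y, h, hyg, hyx⟩))
      have hyv : y ≠ v := fun h => hyk (h ▸ self_mem_bfsBall T.graph v k)
      refine Finset.mem_biUnion.mpr ⟨y, Finset.mem_filter.mpr
        ⟨Finset.mem_sdiff.mpr ⟨hy, hyk⟩, hyg.resolve_left hyv⟩, ?_⟩
      simp [hyx, hx']
    calc _ ≤ _ := Finset.card_le_card hsub
      _ ≤ L.card * 5 := Finset.card_biUnion_le_card_mul _ _ _ fun y hy => by
        obtain ⟨hy, hdeg⟩ := Finset.mem_filter.mp hy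
        obtain ⟨hy, hyk⟩ := Finset.mem_sdiff.mp hy
        exact card_neighborFinset_sdiff_bfsBall_le T hy hyk hdeg
      _ ≤ 5 ^ k * vdeg T.graph v * 5 :=
        Nat.mul_le_mul_right _ ((Finset.card_filter_le _ _).trans ih)
      _ = 5 ^ (k + 1) * vdeg T.graph v := by ring

theorem card_bfsBall_lt (T : PlaneTriangulation V) (v : V) (k : ℕ) :
    (bfsBall T.graph v k).card < 5 ^ k * vdeg T.graph v := by
  classical
  induction k with
  | zero =>
    have := T.two_le_vdeg v
    simp only [bfsBall, Finset.card_singleton, pow_zero, one_mul]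
    omega
  | succ k ih =>
    have h1 := card_bfsBall_succ_sdiff_le T v k
    have h2 := Finset.card_sdiff_add_card_eq_card (bfsBall_mono T.graph v k.le_succ)
    have h3 := T.two_le_vdeg v
    rw [Nat.succ_eq_add_one] at h2
    rw [pow_succ, Nat.mul_right_comm]
    omega

end Growth

end FourColor

open FourColor in
/-- For every vertex `v₀` of a planar triangulation `G` and
every `k ≥ 0`, the extended degree-bounded ball satisfies
`|V(B̄^8_k(v₀))| < 5^k · d(v₀)`. -/
theorem extended_ball_size_bound
    (V : Type) [Fintype V] (T : PlaneTriangulation V) (v₀ : V) (k : ℕ) :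
    (extdBallSet T.graph v₀ k).ncard < 5 ^ k * vdeg T.graph v₀ := by
  refine lt_of_le_of_lt ?_ (card_bfsBall_lt T v₀ k)
  rw [← Set.ncard_coe_finset]
  exact Set.ncard_le_ncard (extdBallSet_subset_bfsBall T.graph v₀ k)
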